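/- There exists an absolute constant C > 0 such that for every integer k ≥ 2 and every integer n ≥ C·k·log k, one has M_k(n)^{k/n} ≤ C·k^{1/4}. -/

import Mathlib

/-- `numOcc v w` is the number of occurrences of `v` as a subsequence of `w`, i.e. the
number of strictly increasing maps `f : Fin |v| → Fin |w|` with `v⟨i⟩ = w⟨f i⟩`. -/
noncomputable def numOcc {α : Type*} (v w : List α) : ℕ :=
  Nat.card {f : Fin v.length → Fin w.length //
    StrictMono f ∧ ∀ i : Fin v.length, v.get i = w.get (f i)}

/-- `maxOcc w = M(w)`, the maximum over all words `v` of `numOcc v w`. -/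
noncomputable def maxOcc {α : Type*} (w : List α) : ℕ :=
  sSup {m | ∃ v : List α, numOcc v w = m}

/-- `Mmin k n = M_k(n)`, the minimum of `M(w)` over all words `w` of length `n`
over a `k`-letter alphabet. -/
noncomputable def Mmin (k n : ℕ) : ℕ :=
  sInf {m | ∃ w : List (Fin k), w.length = n ∧ maxOcc w = m}

/-- Recursive count of occurrences. -/
def occ {α : Type*} [DecidableEq α] : List α → List α → ℕ
  | [], _ => 1
  | _ :: _, [] => 0
  | a :: v, b :: w => occ (a :: v) w + if a = b then occ v w else 0

section occ
variable {α : Type*} [DecidableEq α]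

@[simp] lemma occ_nil (w : List α) : occ [] w = 1 := by cases w <;> rfl
@[simp] lemma occ_cons_nil (a : α) (v : List α) : occ (a :: v) [] = 0 := rfl
lemma occ_cons_cons (a b : α) (v w : List α) :
    occ (a :: v) (b :: w) = occ (a :: v) w + if a = b then occ v w else 0 := by
  rw [occ]

lemma numOcc_le_occ (w : List α) : ∀ v : List α, numOcc v w ≤ occ v w := by
  induction w with
  | nil =>
    intro v
    cases v with
    | nil =>
      rw [occ_nil, numOcc]
      exact Finite.card_le_one_iff_subsingleton.2 ⟨fun f g => Subtype.ext (funext fun i => i.elim0)⟩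
    | cons a v =>
      rw [numOcc]
      have : IsEmpty {f : Fin (a :: v).length → Fin ([] : List α).length //
        StrictMono f ∧ ∀ i : Fin (a :: v).length, (a :: v).get i = ([] : List α).get (f i)} :=
        ⟨fun f => (f.1 ⟨0, by simp⟩).elim0⟩
      simp
  | cons b w ih =>
    intro v
    cases v with
    | nil =>
      rw [occ_nil, numOcc]
      exact Finite.card_le_one_iff_subsingleton.2 ⟨fun f g => Subtype.ext (funext fun i => i.elim0)⟩
    | cons a v =>
      rw [occ_cons_cons]
      let S (v w : List α) := {f : Fin v.length → Fin w.length //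
        StrictMono f ∧ ∀ i : Fin v.length, v.get i = w.get (f i)}
      have key : numOcc (a :: v) (b :: w) ≤ numOcc (a :: v) w + if a = b then numOcc v w else 0 := by
        let X := {f : S (a :: v) (b :: w) // f.1 ⟨0, by simp⟩ ≠ ⟨0, by simp⟩}
        let Y := {f : S (a :: v) (b :: w) // ¬ (f.1 ⟨0, by simp⟩ ≠ ⟨0, by simp⟩)}
        have hXY : numOcc (a :: v) (b :: w) = Nat.card X + Nat.card Y := by
          rw [← Nat.card_sum]
          exact Nat.card_congr (Equiv.sumCompl _).symm
        have hpos : ∀ f : X, ∀ i, 0 < (f.1.1 i).val := by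
          intro f i
          have h0 : 0 < (f.1.1 ⟨0, by simp⟩).val := by
            rcases Nat.eq_zero_or_pos (f.1.1 ⟨0, by simp⟩).val with h | h
            · exact absurd (Fin.ext h) f.2
            · exact h
          have : f.1.1 ⟨0, by simp⟩ ≤ f.1.1 i := f.1.2.1.monotone (Fin.mk_le_of_le_val (Nat.zero_le _))
          exact lt_of_lt_of_le h0 this
        have hX : Nat.card X ≤ numOcc (a :: v) w := by
          refine Nat.card_le_card_of_injective (β := S (a :: v) w)
            (fun f => ⟨fun i => ⟨(f.1.1 i).val - 1, by
              have := (f.1.1 i).2; have := hpos f i; simp at *; omega⟩, ?_, ?_⟩) ?_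
          · intro i j hij
            have := f.1.2.1 hij
            have h1 := hpos f i
            simp only [Fin.lt_def] at *
            omega
          · intro i
            rw [f.1.2.2 i]
            have h1 := hpos f i
            obtain ⟨m, hm⟩ : ∃ m, (f.1.1 i).val = m + 1 := ⟨_, (Nat.succ_pred_eq_of_pos h1).symm⟩
            simp [hm]
          · intro f g h
            have h' := congrArg Subtype.val h
            refine Subtype.ext (Subtype.ext (funext fun i => Fin.ext ?_))
            have := congrArg Fin.val (congrFun h' i)
            have h1 := hpos f i
            have h2 := hpos g i
            simp only at this
            omega
        have hY0 : ∀ f : Y, (f.1.1 ⟨0, by simp⟩).val = 0 := by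
          intro f
          have := not_not.1 f.2
          rw [this]
        have hYpos : ∀ f : Y, ∀ i : Fin v.length, 0 < (f.1.1 ⟨i.val + 1, by simp⟩).val := by
          intro f i
          have : f.1.1 ⟨0, by simp⟩ < f.1.1 ⟨i.val + 1, by simp⟩ := f.1.2.1 (by simp [Fin.lt_def])
          exact lt_of_le_of_lt (Nat.zero_le _) this
        have hY : Nat.card Y ≤ if a = b then numOcc v w else 0 := by
          split_ifs with hab
          · refine Nat.card_le_card_of_injective (β := S v w)
              (fun f => ⟨fun i => ⟨(f.1.1 ⟨i.val + 1, by simp⟩).val - 1, by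
                have := (f.1.1 ⟨i.val + 1, by simp⟩).2; have := hYpos f i; simp at *; omega⟩, ?_, ?_⟩) ?_
            · intro i j hij
              have : f.1.1 ⟨i.val + 1, by simp⟩ < f.1.1 ⟨j.val + 1, by simp⟩ :=
                f.1.2.1 (Fin.mk_lt_mk.2 (Nat.succ_lt_succ hij))
              have h1 := hYpos f i
              simp only [Fin.lt_def] at *
              omega
            · intro i
              have h2 := f.1.2.2 ⟨i.val + 1, by simp⟩
              have h1 := hYpos f i
              obtain ⟨m, hm⟩ : ∃ m, (f.1.1 ⟨i.val + 1, by simp⟩).val = m + 1 :=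
                ⟨_, (Nat.succ_pred_eq_of_pos h1).symm⟩
              simpa [hm] using h2
            · intro f g h
              have h' := congrArg Subtype.val h
              refine Subtype.ext (Subtype.ext (funext fun i => Fin.ext ?_))
              rcases i with ⟨i, hi⟩
              cases i with
              | zero => rw [hY0 f, hY0 g]
              | succ i =>
                have hi' : i < v.length := by simpa using hi
                have := congrArg Fin.val (congrFun h' ⟨i, hi'⟩)
                have h1 := hYpos f ⟨i, hi'⟩
                have h2 := hYpos g ⟨i, hi'⟩
                simp only at this h1 h2
                omega
          · have : IsEmpty Y := ⟨fun f => hab (by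
              have h2 := f.1.2.2 ⟨0, by simp⟩
              rw [not_not.1 f.2] at h2
              exact h2)⟩
            simp
        omega
      refine key.trans (Nat.add_le_add (ih _) ?_)
      split_ifs
      · exact ih _
      · exact le_rfl

lemma occ_append (w₂ : List α) : ∀ w₁ v : List α, occ v (w₁ ++ w₂) =
    ∑ x ∈ Finset.range (v.length + 1), occ (v.take x) w₁ * occ (v.drop x) w₂ := by
  intro w₁
  induction w₁ with
  | nil =>
    intro v
    rw [Finset.sum_range_succ']
    cases v with
    | nil => simp
    | cons a v => simp
  | cons b w₁ ih =>
    intro v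
    cases v with
    | nil => simp
    | cons a v =>
      rw [List.cons_append, occ_cons_cons, ih, ih]
      rw [List.length_cons, Finset.sum_range_succ', Finset.sum_range_succ' (n := v.length + 1)]
      simp only [List.take_succ_cons, List.drop_succ_cons, List.take_zero, List.drop_zero, occ_nil,
        occ_cons_cons, add_mul, Finset.sum_add_distrib]
      split_ifs with h <;> simp <;> ring

lemma occ_pos_sublist (w : List α) : ∀ v : List α, 0 < occ v w → v.Sublist w := by
  induction w with
  | nil => intro v; cases v <;> simp
  | cons b w ih =>
    intro v
    cases v with
    | nil => simp
    | cons a v =>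
      rw [occ_cons_cons]
      intro h
      by_cases h1 : 0 < occ (a :: v) w
      · exact (ih _ h1).cons b
      · split_ifs at h with hab
        · subst hab
          exact (ih v (by omega)).cons_cons a
        · omega

lemma occ_mono {w w' : List α} (h : w.Sublist w') : ∀ v : List α, occ v w ≤ occ v w' := by
  induction h with
  | slnil => intro v; exact le_rfl
  | cons b h ih =>
    intro v
    cases v with
    | nil => simp
    | cons a v => rw [occ_cons_cons]; exact (ih _).trans (Nat.le_add_right _ _)
  | cons_cons b h ih =>
    intro v
    cases v with
    | nil => simp
    | cons a v =>
      rw [occ_cons_cons, occ_cons_cons]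
      refine Nat.add_le_add (ih _) ?_
      split_ifs
      · exact ih _
      · exact le_rfl

lemma occ_nodup {w : List α} (h : w.Nodup) : ∀ v : List α, occ v w ≤ 1 := by
  induction w with
  | nil => intro v; cases v <;> simp
  | cons b w ih =>
    intro v
    cases v with
    | nil => simp
    | cons a v =>
      rw [occ_cons_cons]
      rw [List.nodup_cons] at h
      split_ifs with hab
      · have : occ (a :: v) w = 0 := by
          by_contra hne
          have := (occ_pos_sublist w _ (Nat.pos_of_ne_zero hne)).subset (List.mem_cons_self)
          exact h.1 (hab ▸ this)
        rw [this, zero_add]; exact ih h.2 v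
      · exact ih h.2 _

end occ

section main
variable {α : Type*} [DecidableEq α]

lemma card_le_of_diam (S : Finset ℕ) (L : ℕ) (h : ∀ x ∈ S, ∀ y ∈ S, x ≤ y → y - x ≤ L) :
    S.card ≤ L + 1 := by
  rcases S.eq_empty_or_nonempty with rfl | hne
  · simp
  · have hsub : S ⊆ Finset.Icc (S.min' hne) (S.min' hne + L) := by
      intro y hy
      have h1 := S.min'_le y hy
      have h2 := h _ (S.min'_mem hne) y hy h1
      rw [Finset.mem_Icc]; omega
    refine (Finset.card_le_card hsub).trans ?_
    rw [Nat.card_Icc]; omega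

/-- Crude submultiplicativity. -/
lemma occ_append_le (w₁ w₂ : List α) (A B : ℕ) (hA : ∀ v, occ v w₁ ≤ A) (hB : ∀ v, occ v w₂ ≤ B)
    (v : List α) : occ v (w₁ ++ w₂) ≤ (w₁.length + 1) * A * B := by
  rw [occ_append]
  have h1 : ∀ x ∈ Finset.range (v.length + 1), occ (v.take x) w₁ * occ (v.drop x) w₂ ≤
      if x ∈ Finset.range (w₁.length + 1) then A * B else 0 := by
    intro x hx
    rw [Finset.mem_range] at hx
    split_ifs with h
    · exact Nat.mul_le_mul (hA _) (hB _)
    · have : occ (v.take x) w₁ = 0 := by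
        by_contra hne
        have := (occ_pos_sublist _ _ (Nat.pos_of_ne_zero hne)).length_le
        rw [List.length_take] at this
        rw [Finset.mem_range] at h
        omega
      simp [this]
  refine (Finset.sum_le_sum h1).trans ?_
  rw [← Finset.sum_filter, Finset.sum_const, smul_eq_mul, mul_assoc]
  refine Nat.mul_le_mul_right _ ?_
  calc _ ≤ (Finset.range (w₁.length + 1)).card := Finset.card_le_card (by
        intro x hx; exact (Finset.mem_filter.1 hx).2)
    _ = _ := by simp

/-- Concatenation of the first `i` blocks. -/
def cat (B : ℕ → List α) : ℕ → List α
  | 0 => []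
  | i + 1 => cat B i ++ B i

lemma piece_sublist {v W C : List α} {x x' : ℕ} (h : (v.take x').Sublist (W ++ C))
    (hx : ¬ (v.take x).Sublist W) : ((v.take x').drop x).Sublist C := by
  obtain ⟨l1, l2, he, h1, h2⟩ := List.sublist_append_iff.1 h
  have hl : l1.length < x := by
    by_contra hge
    push Not at hge
    apply hx
    refine List.Sublist.trans ?_ h1
    have e1 : l1 = (v.take x').take l1.length := by rw [he]; simp
    rw [e1, List.take_take]
    refine (List.take_prefix_take_left ?_).sublist
    have : l1.length ≤ (v.take x').length := by rw [he]; simp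
    rw [List.length_take] at this
    omega
  rw [he, List.drop_append, List.drop_eq_nil_of_le hl.le, List.nil_append]
  exact (List.drop_sublist _ _).trans h2

lemma occ_cat_le (B : ℕ → List α) (p L : ℕ) (h2 : ∀ i u, occ u (B i) ≤ 2)
    (hL : ∀ i j, i < j → j < p → ∀ u : List α, u.Sublist (B i) → u.Sublist (B j) → u.length ≤ L)
    (v : List α) : ∀ i, i ≤ p → ∀ y ≤ v.length, ∀ j, (v.take y).Sublist (cat B j) →
      occ (v.take y) (cat B i) ≤ (2 * (L + 1)) ^ i * 2 ^ (i + j) := by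
  intro i
  induction i with
  | zero =>
    intro _ y hy j _
    have : occ (v.take y) (cat B 0) ≤ 1 := by
      rw [cat]; cases v.take y <;> simp
    exact this.trans (by simpa using Nat.one_le_two_pow)
  | succ i ih =>
    intro hi y hy j hj
    rw [cat, occ_append]
    have hlen : (v.take y).length = y := by simp [hy]
    rw [hlen]
    set F : ℕ → ℕ := fun x => occ ((v.take y).take x) (cat B i) * occ ((v.take y).drop x) (B i) with hF
    set X := (Finset.range (y + 1)).filter (fun x => F x ≠ 0) with hX
    have hsum : ∑ x ∈ Finset.range (y + 1), F x = ∑ x ∈ X, F x := by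
      rw [hX, Finset.sum_filter_ne_zero]
    rw [hsum]
    classical
    -- properties of elements of X
    have hXle : ∀ x ∈ X, x ≤ y := by
      intro x hx
      have := Finset.mem_range.1 (Finset.mem_filter.1 hx).1
      omega
    have htake : ∀ x ∈ X, (v.take y).take x = v.take x := by
      intro x hx
      rw [List.take_take, min_eq_left (hXle x hx)]
    have hX1 : ∀ x ∈ X, (v.take x).Sublist (cat B i) := by
      intro x hx
      rw [← htake x hx]
      apply occ_pos_sublist
      have := (Finset.mem_filter.1 hx).2
      exact Nat.pos_of_ne_zero (left_ne_zero_of_mul this)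
    have hX2 : ∀ x ∈ X, ((v.take y).drop x).Sublist (B i) := by
      intro x hx
      apply occ_pos_sublist
      have := (Finset.mem_filter.1 hx).2
      exact Nat.pos_of_ne_zero (right_ne_zero_of_mul this)
    have hXj : ∀ x ∈ X, (v.take x).Sublist (cat B j) := by
      intro x hx
      refine List.Sublist.trans ?_ hj
      rw [← htake x hx]
      exact List.take_sublist _ _
    -- class of a position
    have hex : ∀ x : ℕ, ∃ c, x ∈ X → ((v.take x).Sublist (cat B c) ∧
        ∀ c' < c, ¬ (v.take x).Sublist (cat B c')) := by
      intro x
      by_cases hx : x ∈ X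
      · have he : ∃ c, (v.take x).Sublist (cat B c) := ⟨i, hX1 x hx⟩
        exact ⟨Nat.find he, fun _ => ⟨Nat.find_spec he, fun c' hc' => Nat.find_min he hc'⟩⟩
      · exact ⟨0, fun h => absurd h hx⟩
    choose J hJ using hex
    have hJi : ∀ x ∈ X, J x ≤ i := by
      intro x hx
      by_contra h
      push Not at h
      exact (hJ x hx).2 i h (hX1 x hx)
    have hJj : ∀ x ∈ X, J x ≤ j := by
      intro x hx
      by_contra h
      push Not at h
      exact (hJ x hx).2 j h (hXj x hx)
    have hfib : ∀ c, (X.filter (fun x => J x = c)).card ≤ L + 1 := by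
      intro c
      apply card_le_of_diam
      intro x hx x' hx' hxx'
      obtain ⟨hxX, hxc⟩ := Finset.mem_filter.1 hx
      obtain ⟨hxX', hxc'⟩ := Finset.mem_filter.1 hx'
      have hl' : (v.take x').length = x' := by
        have := hXle x' hxX'
        simp; omega
      cases c with
      | zero =>
        have h := (hJ x' hxX').1
        rw [hxc', cat] at h
        have := h.length_le
        rw [hl'] at this
        simp at this
        omega
      | succ c =>
        have ha := (hJ x' hxX').1
        rw [hxc', cat] at ha
        have hb := (hJ x hxX).2 c (by omega)
        have h3 := piece_sublist ha hb
        have h4 : ((v.take x').drop x).Sublist (B i) := by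
          refine List.Sublist.trans ?_ (hX2 x hxX)
          refine List.Sublist.drop ?_ x
          rw [← htake x' hxX']
          exact List.take_sublist _ _
        have hci := hJi x hxX
        have := hL c i (by omega) (by omega) _ h3 h4
        rw [List.length_drop, hl'] at this
        exact this
    have hterm : ∀ x ∈ X, F x ≤ (2 * (L + 1)) ^ i * 2 ^ (i + J x) * 2 := by
      intro x hx
      refine Nat.mul_le_mul ?_ (h2 _ _)
      rw [htake x hx]
      exact ih (by omega) x ((hXle x hx).trans hy) (J x) (hJ x hx).1
    have hmaps : ∀ x ∈ X, J x ∈ Finset.range (j + 1) := by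
      intro x hx
      have := hJj x hx
      simp; omega
    calc ∑ x ∈ X, F x ≤ ∑ x ∈ X, (2 * (L + 1)) ^ i * 2 ^ (i + J x) * 2 := Finset.sum_le_sum hterm
      _ = ∑ c ∈ Finset.range (j + 1), ∑ x ∈ X with J x = c, (2 * (L + 1)) ^ i * 2 ^ (i + J x) * 2 :=
          (Finset.sum_fiberwise_of_maps_to hmaps _).symm
      _ ≤ ∑ c ∈ Finset.range (j + 1), (L + 1) * ((2 * (L + 1)) ^ i * 2 ^ (i + c) * 2) := by
          refine Finset.sum_le_sum fun c _ => ?_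
          rw [Finset.sum_congr rfl (g := fun _ => (2 * (L + 1)) ^ i * 2 ^ (i + c) * 2)
            (fun x hx => by rw [(Finset.mem_filter.1 hx).2]), Finset.sum_const, smul_eq_mul]
          exact Nat.mul_le_mul_right _ (hfib c)
      _ = (2 * (L + 1)) ^ (i + 1) * 2 ^ i * ∑ c ∈ Finset.range (j + 1), 2 ^ c := by
          rw [Finset.mul_sum]
          refine Finset.sum_congr rfl fun c _ => ?_
          ring
      _ ≤ (2 * (L + 1)) ^ (i + 1) * 2 ^ i * 2 ^ (j + 1) := by
          refine Nat.mul_le_mul_left _ ?_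
          exact (Nat.geomSum_lt (le_refl 2) (by intro k hk; exact Finset.mem_range.1 hk)).le
      _ = _ := by ring

lemma occ_cat (B : ℕ → List α) (p L : ℕ) (h2 : ∀ i u, occ u (B i) ≤ 2)
    (hL : ∀ i j, i < j → j < p → ∀ u : List α, u.Sublist (B i) → u.Sublist (B j) → u.length ≤ L)
    (i : ℕ) (hi : i ≤ p) (v : List α) : occ v (cat B i) ≤ (8 * (L + 1)) ^ i := by
  by_cases h : v.Sublist (cat B i)
  · have := occ_cat_le B p L h2 hL v i hi v.length le_rfl i (by simpa using h)
    rw [List.take_length] at this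
    refine this.trans (le_of_eq ?_)
    rw [← two_mul, pow_mul, ← mul_pow]
    congr 1; ring
  · have : occ v (cat B i) = 0 := by
      by_contra hne
      exact h (occ_pos_sublist _ _ (Nat.pos_of_ne_zero hne))
    rw [this]; exact Nat.zero_le _

/-- Long words from the `p` blocks. -/
lemma exists_long (B : ℕ → List α) (p L N : ℕ) (hp : 0 < p) (hN : ∀ i, (B i).length = N)
    (h2 : ∀ i u, occ u (B i) ≤ 2)
    (hL : ∀ i j, i < j → j < p → ∀ u : List α, u.Sublist (B i) → u.Sublist (B j) → u.length ≤ L)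
    (t : ℕ) : ∃ w : List α, w.length = t * N ∧
      ∀ v, occ v w ≤ (p * N + 1) ^ (t / p + 1) * (8 * (L + 1)) ^ t := by
  have hcl : ∀ i, (cat B i).length = i * N := by
    intro i
    induction i with
    | zero => simp [cat]
    | succ i ih => rw [cat, List.length_append, ih, hN]; ring
  induction t using Nat.strong_induction_on with
  | _ t ih =>
    by_cases htp : t < p
    · refine ⟨cat B t, hcl t, fun v => ?_⟩
      refine (occ_cat B p L h2 hL t htp.le v).trans ?_
      exact Nat.le_mul_of_pos_left _ (by positivity)
    · push Not at htp
      obtain ⟨w, hw, hb⟩ := ih (t - p) (by omega)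
      obtain ⟨s, rfl⟩ : ∃ s, t = s + p := ⟨t - p, by omega⟩
      rw [Nat.add_sub_cancel] at hw hb
      refine ⟨cat B p ++ w, ?_, fun v => ?_⟩
      · rw [List.length_append, hcl, hw]; ring
      · refine (occ_append_le _ _ _ _ (occ_cat B p L h2 hL p le_rfl) hb v).trans (le_of_eq ?_)
        rw [hcl, Nat.add_div_right _ hp]
        ring
end main

section perms

lemma pair_nodup {α : Type*} {a b : α} {w : List α} (hw : w.Nodup)
    (h1 : [a, b].Sublist w) (h2 : [b, a].Sublist w) : False := by
  induction w with
  | nil => simp at h1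
  | cons c w ih =>
    rw [List.nodup_cons] at hw
    cases h1 with
    | cons _ h1 =>
      cases h2 with
      | cons _ h2 => exact ih hw.2 h1 h2
      | cons_cons _ h2 => exact hw.1 (h1.subset (by simp))
    | cons_cons _ h1 =>
      cases h2 with
      | cons _ h2 => exact hw.1 (h2.subset (by simp))
      | cons_cons _ h2 => exact hw.1 (h2.subset (by simp))

lemma length_le_one {α : Type*} {m w : List α} (hw : w.Nodup)
    (h1 : m.Sublist w) (h2 : m.Sublist w.reverse) : m.length ≤ 1 := by
  match m with
  | [] => simp
  | [a] => simp
  | a :: b :: m =>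
    exfalso
    have hab : [a, b].Sublist (a :: b :: m) := by simp
    have h3 := (hab.trans h2).reverse
    rw [List.reverse_reverse] at h3
    exact pair_nodup hw (hab.trans h1) (by simpa using h3)

lemma occ_unimodal {α : Type*} [DecidableEq α] {w : List α} (hw : w.Nodup) (u : List α) :
    occ u (w ++ w.reverse) ≤ 2 := by
  rw [occ_append]
  set F : ℕ → ℕ := fun x => occ (u.take x) w * occ (u.drop x) w.reverse with hF
  rw [← Finset.sum_filter_ne_zero]
  have h1 : ∀ x, F x ≤ 1 := fun x =>
    (Nat.mul_le_mul (occ_nodup hw _) (occ_nodup (List.nodup_reverse.2 hw) _)).trans (by simp)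
  refine (Finset.sum_le_card_nsmul _ _ 1 (fun x _ => h1 x)).trans ?_
  rw [smul_eq_mul, mul_one]
  apply card_le_of_diam
  intro x hx y hy hxy
  have hx2 := (Finset.mem_filter.1 hx).2
  have hy2 := (Finset.mem_filter.1 hy).2
  have hyl := Finset.mem_range.1 (Finset.mem_filter.1 hy).1
  have a1 := occ_pos_sublist _ _ (Nat.pos_of_ne_zero (left_ne_zero_of_mul hy2))
  have a2 := occ_pos_sublist _ _ (Nat.pos_of_ne_zero (right_ne_zero_of_mul hx2))
  have := length_le_one (m := (u.take y).drop x) hw ((List.drop_sublist _ _).trans a1)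
    (((List.take_sublist _ _).drop x).trans a2)
  rw [List.length_drop, List.length_take] at this
  omega

/-- Common subsequences of two unimodal blocks. -/
lemma common_block {α : Type*} {w w' : List α} {L : ℕ}
    (h1 : ∀ u : List α, u.Sublist w → u.Sublist w' → u.length ≤ L)
    (h2 : ∀ u : List α, u.Sublist w.reverse → u.Sublist w' → u.length ≤ L)
    (u : List α) (hu : u.Sublist (w ++ w.reverse)) (hu' : u.Sublist (w' ++ w'.reverse)) :
    u.length ≤ 4 * L := by
  have h3 : ∀ u : List α, u.Sublist w → u.Sublist w'.reverse → u.length ≤ L := by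
    intro u ha hb
    rw [← List.length_reverse]
    exact h2 _ ha.reverse (by simpa using hb.reverse)
  have h4 : ∀ u : List α, u.Sublist w.reverse → u.Sublist w'.reverse → u.length ≤ L := by
    intro u ha hb
    rw [← List.length_reverse]
    exact h1 _ (by simpa using ha.reverse) (by simpa using hb.reverse)
  obtain ⟨a, b, rfl, ha, hb⟩ := List.sublist_append_iff.1 hu
  obtain ⟨a1, a2, rfl, ha1, ha2⟩ :=
    List.sublist_append_iff.1 ((List.sublist_append_left a b).trans hu')
  obtain ⟨b1, b2, rfl, hb1, hb2⟩ :=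
    List.sublist_append_iff.1 ((List.sublist_append_right _ b).trans hu')
  have e1 := h1 a1 ((List.sublist_append_left _ _).trans ha) ha1
  have e2 := h3 a2 ((List.sublist_append_right _ _).trans ha) ha2
  have e3 := h2 b1 ((List.sublist_append_left _ _).trans hb) hb1
  have e4 := h4 b2 ((List.sublist_append_right _ _).trans hb) hb2
  simp only [List.length_append]
  omega

open Classical in
/-- Few permutations order the image of an embedding increasingly. -/
lemma card_mono_le {k L : ℕ} (x : Fin L ↪ Fin k) :
    L.factorial * (Finset.univ.filter (fun τ : Equiv.Perm (Fin k) =>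
      StrictMono (fun i => τ.symm (x i)))).card ≤ k.factorial := by
  set T : (Fin L ↪ Fin k) → Finset (Equiv.Perm (Fin k)) := fun x =>
    Finset.univ.filter (fun τ : Equiv.Perm (Fin k) => StrictMono (fun i => τ.symm (x i))) with hT
  have hsame : ∀ x y, (T x).card ≤ (T y).card := by
    intro x y
    obtain ⟨g, hg⟩ := Equiv.Perm.exists_extending_pair x y x.injective y.injective
    refine Finset.card_le_card_of_injOn (fun τ => g * τ) ?_ ?_
    · intro τ hτ
      have h := (Finset.mem_filter.1 hτ).2
      refine Finset.mem_coe.2 (Finset.mem_filter.2 ⟨Finset.mem_univ _, ?_⟩)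
      have : (fun i => (g * τ).symm (y i)) = fun i => τ.symm (x i) := by
        funext i
        rw [Equiv.symm_apply_eq]
        have := hg i
        simp [Equiv.Perm.mul_apply, this]
      rw [this]; exact h
    · intro a _ b _ h
      exact mul_left_cancel h
  have hdisj : ((Finset.univ : Finset (Equiv.Perm (Fin L))) : Set (Equiv.Perm (Fin L))).PairwiseDisjoint
      (fun ρ => T (ρ.toEmbedding.trans x)) := by
    intro ρ _ ρ' _ hne
    refine Finset.disjoint_left.2 fun τ h h' => hne ?_
    have m := (Finset.mem_filter.1 h).2
    have m' := (Finset.mem_filter.1 h').2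
    have hr : ∀ ρ : Equiv.Perm (Fin L), Set.range (fun i => τ.symm ((ρ.toEmbedding.trans x) i)) =
        Set.range (fun i => τ.symm (x i)) := by
      intro ρ
      exact EquivLike.range_comp (fun i => τ.symm (x i)) ρ
    have := (StrictMono.range_inj m m').1 ((hr ρ).trans (hr ρ').symm)
    ext i
    have := congrFun this i
    simp at this
    rw [this]
  have := Finset.card_biUnion hdisj
  calc L.factorial * (T x).card = ∑ _ρ : Equiv.Perm (Fin L), (T x).card := by
        rw [Finset.sum_const, Finset.card_univ, Fintype.card_perm, Fintype.card_fin, smul_eq_mul]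
    _ ≤ ∑ ρ : Equiv.Perm (Fin L), (T (ρ.toEmbedding.trans x)).card :=
        Finset.sum_le_sum fun ρ _ => hsame _ _
    _ = _ := this.symm
    _ ≤ (Finset.univ : Finset (Equiv.Perm (Fin k))).card := Finset.card_le_card (Finset.subset_univ _)
    _ = k.factorial := by rw [Finset.card_univ, Fintype.card_perm, Fintype.card_fin]

open Classical in
lemma card_sublist_le {k L : ℕ} (u : List (Fin k)) (hu : u.Nodup) (hL : u.length = L) :
    L.factorial * (Finset.univ.filter (fun τ : Equiv.Perm (Fin k) =>
      u.Sublist (List.ofFn τ))).card ≤ k.factorial := by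
  subst hL
  refine le_trans ?_ (card_mono_le (⟨u.get, List.nodup_iff_injective_get.1 hu⟩ : Fin u.length ↪ Fin k))
  refine Nat.mul_le_mul_left _ (Finset.card_le_card fun τ hτ => ?_)
  have h := (Finset.mem_filter.1 hτ).2
  refine Finset.mem_filter.2 ⟨Finset.mem_univ _, ?_⟩
  obtain ⟨f, hf⟩ := List.sublist_iff_exists_fin_orderEmbedding_get_eq.1 h
  intro i j hij
  have e : ∀ i, τ.symm (u.get i) = Fin.cast (by simp) (f i) := by
    intro i
    rw [Equiv.symm_apply_eq, hf i]
    simp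
    rfl
  show τ.symm (u.get i) < τ.symm (u.get j)
  rw [e, e]
  exact f.strictMono hij

open Classical in
/-- Permutations sharing a long common subsequence with a fixed word without repetitions. -/
lemma card_bad_le {k L : ℕ} (w : List (Fin k)) (hw : w.Nodup) (hk : w.length = k) :
    L.factorial * (Finset.univ.filter (fun τ : Equiv.Perm (Fin k) =>
      ∃ u : List (Fin k), u.length = L ∧ u.Sublist w ∧ u.Sublist (List.ofFn τ))).card
      ≤ k.choose L * k.factorial := by
  set U := (w.sublistsLen L).toFinset with hU
  have hUc : U.card ≤ k.choose L := by
    refine (List.toFinset_card_le _).trans ?_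
    rw [List.length_sublistsLen, hk]
  have hsub : (Finset.univ.filter (fun τ : Equiv.Perm (Fin k) =>
      ∃ u : List (Fin k), u.length = L ∧ u.Sublist w ∧ u.Sublist (List.ofFn τ))) ⊆
      U.biUnion (fun u => Finset.univ.filter (fun τ : Equiv.Perm (Fin k) =>
        u.Sublist (List.ofFn τ))) := by
    intro τ hτ
    obtain ⟨u, h1, h2, h3⟩ := (Finset.mem_filter.1 hτ).2
    refine Finset.mem_biUnion.2 ⟨u, ?_, Finset.mem_filter.2 ⟨Finset.mem_univ _, h3⟩⟩
    rw [hU, List.mem_toFinset, List.mem_sublistsLen]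
    exact ⟨h2, h1⟩
  calc _ ≤ L.factorial * ∑ u ∈ U, (Finset.univ.filter (fun τ : Equiv.Perm (Fin k) =>
        u.Sublist (List.ofFn τ))).card :=
        Nat.mul_le_mul_left _ ((Finset.card_le_card hsub).trans Finset.card_biUnion_le)
    _ ≤ ∑ u ∈ U, k.factorial := by
        rw [Finset.mul_sum]
        refine Finset.sum_le_sum fun u hu => ?_
        rw [hU, List.mem_toFinset, List.mem_sublistsLen] at hu
        exact card_sublist_le u (hu.1.nodup hw) hu.2
    _ ≤ _ := by
        rw [Finset.sum_const, smul_eq_mul]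
        exact Nat.mul_le_mul_right _ hUc

open Classical in
lemma greedy {G : Type*} [Fintype G] [Nonempty G] (R : G → G → Prop) (b p : ℕ)
    (hb : ∀ σ, (Finset.univ.filter (fun τ => R σ τ)).card ≤ b) (hp : p * b < Fintype.card G) :
    ∃ f : ℕ → G, ∀ i j, i < j → j < p → ¬ R (f i) (f j) := by
  induction p with
  | zero => exact ⟨fun _ => Classical.arbitrary G, fun i j _ h => absurd h (Nat.not_lt_zero _)⟩
  | succ p ih =>
    obtain ⟨f, hf⟩ := ih (lt_of_le_of_lt (Nat.mul_le_mul_right _ (Nat.le_succ p)) hp)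
    have hc : ((Finset.range p).biUnion (fun i => Finset.univ.filter (fun τ => R (f i) τ))).card
        < (Finset.univ : Finset G).card := by
      refine lt_of_le_of_lt (Finset.card_biUnion_le.trans
        ((Finset.sum_le_card_nsmul _ _ b fun i _ => hb _))) ?_
      rw [Finset.card_range, smul_eq_mul, Finset.card_univ]
      exact lt_of_le_of_lt (Nat.mul_le_mul_right _ (Nat.le_succ p)) hp
    obtain ⟨τ, _, hτ⟩ := Finset.exists_mem_notMem_of_card_lt_card hc
    refine ⟨Function.update f p τ, fun i j hij hj => ?_⟩
    rw [Function.update_of_ne (by omega : i ≠ p)]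
    by_cases hjp : j = p
    · subst hjp
      rw [Function.update_self]
      intro hR
      exact hτ (Finset.mem_biUnion.2 ⟨i, Finset.mem_range.2 hij,
        Finset.mem_filter.2 ⟨Finset.mem_univ _, hR⟩⟩)
    · rw [Function.update_of_ne hjp]
      exact hf i j hij (by omega)

lemma exists_perms (k L p : ℕ) (h : p * (2 * k.choose L) < L.factorial) :
    ∃ f : ℕ → List (Fin k), (∀ i, (f i).Nodup) ∧ (∀ i, (f i).length = k) ∧
      ∀ i j, i < j → j < p →
        (∀ u : List (Fin k), u.Sublist (f i) → u.Sublist (f j) → u.length ≤ L) ∧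
        (∀ u : List (Fin k), u.Sublist (f i).reverse → u.Sublist (f j) → u.length ≤ L) := by
  classical
  set bad : List (Fin k) → Equiv.Perm (Fin k) → Prop := fun w τ =>
    ∃ u : List (Fin k), u.length = L ∧ u.Sublist w ∧ u.Sublist (List.ofFn τ) with hbad
  have hnd : ∀ σ : Equiv.Perm (Fin k), (List.ofFn σ).Nodup := fun σ =>
    List.nodup_ofFn.2 σ.injective
  have hb : ∀ σ : Equiv.Perm (Fin k), (Finset.univ.filter (fun τ =>
      bad (List.ofFn σ) τ ∨ bad (List.ofFn σ).reverse τ)).card ≤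
      (2 * k.choose L * k.factorial) / L.factorial := by
    intro σ
    rw [Nat.le_div_iff_mul_le (Nat.factorial_pos _), Finset.filter_or]
    have h1 := card_bad_le (L := L) (List.ofFn σ) (hnd σ) (by simp)
    have h2 := card_bad_le (L := L) (List.ofFn σ).reverse (List.nodup_reverse.2 (hnd σ)) (by simp)
    have h3 := Finset.card_union_le (Finset.univ.filter (fun τ => bad (List.ofFn σ) τ))
      (Finset.univ.filter (fun τ => bad (List.ofFn σ).reverse τ))
    calc _ ≤ _ := Nat.mul_le_mul_right _ h3
      _ ≤ _ := by
        rw [add_mul, two_mul, add_mul, mul_comm, mul_comm _ L.factorial]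
        exact Nat.add_le_add h1 h2
  have hp : p * ((2 * k.choose L * k.factorial) / L.factorial) < Fintype.card (Equiv.Perm (Fin k)) := by
    rw [Fintype.card_perm, Fintype.card_fin]
    refine lt_of_le_of_lt (Nat.mul_div_le_mul_div_assoc _ _ _) ?_
    rw [Nat.div_lt_iff_lt_mul (Nat.factorial_pos _), mul_comm k.factorial, ← mul_assoc]
    exact Nat.mul_lt_mul_of_pos_right h (Nat.factorial_pos _)
  obtain ⟨f, hf⟩ := greedy (fun σ τ : Equiv.Perm (Fin k) => bad (List.ofFn σ) τ ∨ bad (List.ofFn σ).reverse τ)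
    ((2 * k.choose L * k.factorial) / L.factorial) p
    (fun σ => by convert hb σ) hp
  have hcut : ∀ (w : List (Fin k)) (τ : Equiv.Perm (Fin k)), ¬ bad w τ →
      ∀ u : List (Fin k), u.Sublist w → u.Sublist (List.ofFn τ) → u.length ≤ L := by
    intro w τ hn u h1 h2
    by_contra hlt
    push Not at hlt
    exact hn ⟨u.take L, by simp; omega, (List.take_sublist _ _).trans h1,
      (List.take_sublist _ _).trans h2⟩
  refine ⟨fun i => List.ofFn (f i), fun i => hnd _, fun i => by simp, fun i j hij hj => ?_⟩
  have := hf i j hij hj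
  push Not at this
  exact ⟨hcut _ _ this.1, hcut _ _ this.2⟩

lemma choose_bound (k p s : ℕ) (hs : k ≤ s * s) (hs1 : 1 ≤ s) (hp : p ≤ k) :
    p * (2 * k.choose (6 * s)) < (6 * s).factorial := by
  set L := 6 * s with hL
  have h1 : L ^ L ≤ 3 ^ L * L.factorial := by
    have h := Real.pow_div_factorial_le_exp (L : ℝ) (Nat.cast_nonneg _) L
    have he : Real.exp (L : ℝ) ≤ 3 ^ L := by
      rw [← mul_one (L : ℝ), Real.exp_nat_mul]
      exact pow_le_pow_left₀ (Real.exp_pos _).le (Real.exp_one_lt_d9.le.trans (by norm_num)) _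
    have hf : (0 : ℝ) < L.factorial := by exact_mod_cast Nat.factorial_pos L
    rw [div_le_iff₀ hf] at h
    have : (L : ℝ) ^ L ≤ 3 ^ L * L.factorial := h.trans (by gcongr)
    exact_mod_cast this
  have h2 : (2 * s) ^ L ≤ L.factorial := by
    have : 3 ^ L * (2 * s) ^ L ≤ 3 ^ L * L.factorial := by
      rw [← mul_pow]
      calc (3 * (2 * s)) ^ L = L ^ L := by rw [hL]; congr 1; ring
        _ ≤ _ := h1
    exact Nat.le_of_mul_le_mul_left this (by positivity)
  have h3 : k.choose L * L.factorial ≤ k ^ L := by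
    rw [mul_comm, ← Nat.descFactorial_eq_factorial_mul_choose]
    exact Nat.descFactorial_le_pow _ _
  have h4 : 2 * p < 4 ^ L := by
    have a1 : s < 2 ^ s := Nat.lt_two_pow_self
    calc 2 * p ≤ 2 * (s * s) := by omega
      _ ≤ 2 * (2 ^ s * 2 ^ s) := by gcongr
      _ = 2 ^ (2 * s + 1) := by ring
      _ < 2 ^ (2 * L) := Nat.pow_lt_pow_right (by norm_num) (by omega)
      _ = 4 ^ L := by rw [pow_mul]; norm_num
  have hfp := Nat.factorial_pos L
  have h5 : 4 ^ L * k ^ L ≤ L.factorial * L.factorial := by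
    calc 4 ^ L * k ^ L ≤ 4 ^ L * (s * s) ^ L := by gcongr
      _ = (2 * s) ^ L * (2 * s) ^ L := by rw [← mul_pow, ← mul_pow]; congr 1; ring
      _ ≤ _ := Nat.mul_le_mul h2 h2
  rcases Nat.eq_zero_or_pos (k ^ L) with h0 | h0
  · rw [h0] at h3
    have : k.choose L = 0 := by
      rcases Nat.mul_eq_zero.1 (Nat.le_zero.1 h3) with h | h
      · exact h
      · omega
    rw [this]; simpa using hfp
  · have : p * (2 * k.choose L) * L.factorial < L.factorial * L.factorial := by
      calc p * (2 * k.choose L) * L.factorial = 2 * p * (k.choose L * L.factorial) := by ring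
        _ ≤ 2 * p * k ^ L := by gcongr
        _ < 4 ^ L * k ^ L := Nat.mul_lt_mul_of_pos_right h4 h0
        _ ≤ _ := h5
    exact Nat.lt_of_mul_lt_mul_right this
end perms

lemma Mmin_le (k n B : ℕ) (w : List (Fin k)) (hw : n ≤ w.length) (h : ∀ v, occ v w ≤ B) :
    Mmin k n ≤ B := by
  have h1 : Mmin k n ≤ maxOcc (w.take n) := Nat.sInf_le ⟨w.take n, by simp [hw], rfl⟩
  refine h1.trans ?_
  refine csSup_le ⟨_, [], rfl⟩ ?_
  rintro m ⟨v, rfl⟩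
  exact (numOcc_le_occ _ v).trans ((occ_mono (List.take_sublist _ _) v).trans (h v))

lemma Mmin_bound (k n : ℕ) (hk : 2 ≤ k) :
    Mmin k n ≤ ((Nat.log 2 k + 1) * (2 * k) + 1) ^ ((n / (2 * k) + 1) / (Nat.log 2 k + 1) + 1) *
      (8 * (4 * (6 * (Nat.sqrt k + 1)) + 1)) ^ (n / (2 * k) + 1) := by
  have hp : Nat.log 2 k + 1 ≤ k := Nat.log_lt_self 2 (by omega)
  obtain ⟨f, hnd, hlen, hf⟩ := exists_perms k (6 * (Nat.sqrt k + 1)) (Nat.log 2 k + 1)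
    (choose_bound k _ (Nat.sqrt k + 1) (Nat.lt_succ_sqrt k).le (by omega) hp)
  obtain ⟨w, hw, hb⟩ := exists_long (fun i => f i ++ (f i).reverse) (Nat.log 2 k + 1)
    (4 * (6 * (Nat.sqrt k + 1))) (2 * k) (by omega)
    (fun i => by rw [List.length_append, List.length_reverse, hlen]; ring)
    (fun i u => occ_unimodal (hnd i) u)
    (fun i j hij hj u hu hu' => common_block (hf i j hij hj).1 (hf i j hij hj).2 u hu hu')
    (n / (2 * k) + 1)
  refine Mmin_le k n _ w ?_ hb
  rw [hw]
  have := Nat.lt_div_mul_add (a := n) (b := 2 * k) (by omega)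
  rw [add_mul]
  omega

/-- There is an absolute constant `C > 0` such that for all `k ≥ 2` and all
`n ≥ C·k·log k`, one has `M_k(n)^{k/n} ≤ C·k^{1/4}`. -/
theorem stmt2 :
    ∃ C : ℝ, 0 < C ∧ ∀ k n : ℕ, 2 ≤ k → C * k * Real.log k ≤ n →
      (Mmin k n : ℝ) ^ ((k : ℝ) / (n : ℝ)) ≤ C * (k : ℝ) ^ ((1 : ℝ) / 4) := by
  refine ⟨Real.exp 40, Real.exp_pos _, fun k n hk hn => ?_⟩
  have hkR : (2 : ℝ) ≤ k := by exact_mod_cast hk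
  have hk0 : (0 : ℝ) < k := by linarith
  set l := Real.log k with hl
  have hl2 : (1 / 2 : ℝ) ≤ l := by
    have h1 := Real.log_two_gt_d9
    have h2 := Real.log_le_log (by norm_num) hkR
    linarith
  have hkexp : (k : ℝ) = Real.exp l := (Real.exp_log hk0).symm
  have hC1 : (1 : ℝ) ≤ Real.exp 40 := Real.one_le_exp (by norm_num)
  have hkl : (k : ℝ) * l ≤ n := by
    refine le_trans ?_ hn
    rw [mul_assoc]
    exact le_mul_of_one_le_left (by positivity) hC1
  have hn0 : (0 : ℝ) < n := lt_of_lt_of_le (by positivity) hkl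
  set a : ℝ := (k : ℝ) / n with ha
  have ha0 : 0 ≤ a := by positivity
  have hal : a * l ≤ 1 := by
    rw [ha, div_mul_eq_mul_div, div_le_one hn0]; exact hkl
  have ha2 : a ≤ 2 := by nlinarith
  set p := Nat.log 2 k + 1 with hp
  set t := n / (2 * k) + 1 with ht
  have hpl : l ≤ p := by
    have h1 : k < 2 ^ p := Nat.lt_pow_succ_log_self (by norm_num) k
    have h2 : (k : ℝ) ≤ 2 ^ p := by exact_mod_cast h1.le
    have h3 := Real.log_le_log hk0 h2
    rw [Real.log_pow] at h3
    have h4 := Real.log_two_lt_d9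
    have h5 : (0 : ℝ) ≤ p := Nat.cast_nonneg _
    nlinarith
  have hp0 : (0 : ℝ) < p := by linarith
  have hta : (t : ℝ) * a ≤ 1 / 2 + a := by
    have h1 : ((n / (2 * k) : ℕ) : ℝ) ≤ (n : ℝ) / (2 * k) := by
      have := @Nat.cast_div_le ℝ _ _ _ n (2 * k)
      push_cast at this
      exact this
    have h2 : (n : ℝ) / (2 * k) * a = 1 / 2 := by
      rw [ha]; field_simp
    have h3 : (t : ℝ) = ((n / (2 * k) : ℕ) : ℝ) + 1 := by rw [ht]; push_cast; ring
    rw [h3, add_mul, one_mul]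
    have := mul_le_mul_of_nonneg_right h1 ha0
    linarith
  have ht0 : (0 : ℝ) ≤ t := Nat.cast_nonneg _
  -- bounds on the bases
  have hD : (((p * (2 * k) + 1 : ℕ)) : ℝ) ≤ Real.exp (4 * l) := by
    have hpk : p ≤ k := Nat.log_lt_self 2 (by omega)
    have h1 : p * (2 * k) + 1 ≤ k ^ 4 := by
      have : p * (2 * k) ≤ k * (2 * k) := Nat.mul_le_mul_right _ hpk
      have h4 : 4 ≤ k * k := Nat.mul_le_mul hk hk
      nlinarith
    have h2 : Real.exp (4 * l) = (k : ℝ) ^ 4 := by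
      rw [hkexp, ← Real.exp_nat_mul]; norm_num
    rw [h2]
    exact_mod_cast h1
  have hsq : Real.sqrt k = Real.exp (l / 2) := by
    rw [hkexp, Real.exp_half]
  have hE : (((8 * (4 * (6 * (Nat.sqrt k + 1)) + 1) : ℕ)) : ℝ) ≤ Real.exp (7 + l / 2) := by
    have h1 : ((Nat.sqrt k : ℕ) : ℝ) ≤ Real.sqrt k := Real.nat_sqrt_le_real_sqrt
    have h2 : (1 : ℝ) ≤ Real.sqrt k := by
      rw [Real.one_le_sqrt]; linarith
    have h3 : (400 : ℝ) ≤ Real.exp 7 := by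
      have h4 : Real.exp 7 = Real.exp 1 ^ 7 := by
        rw [← Real.exp_nat_mul]; norm_num
      rw [h4]
      have h5 : (2.7 : ℝ) ≤ Real.exp 1 := by linarith [Real.exp_one_gt_d9]
      calc (400 : ℝ) ≤ 2.7 ^ 7 := by norm_num
        _ ≤ _ := pow_le_pow_left₀ (by norm_num) h5 7
    rw [Real.exp_add, ← hsq]
    push_cast
    nlinarith
  set q := t / p + 1 with hq
  have hM : (Mmin k n : ℝ) ≤ Real.exp (q * (4 * l) + t * (7 + l / 2)) := by
    have h1 : (Mmin k n : ℝ) ≤ (((p * (2 * k) + 1 : ℕ)) : ℝ) ^ q *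
        (((8 * (4 * (6 * (Nat.sqrt k + 1)) + 1) : ℕ)) : ℝ) ^ t := by
      exact_mod_cast Mmin_bound k n hk
    refine h1.trans ?_
    rw [Real.exp_add, Real.exp_nat_mul, Real.exp_nat_mul]
    gcongr
  have hqa : (q : ℝ) * a * l ≤ 1 / 2 + 2 + 1 := by
    have h1 : ((t / p : ℕ) : ℝ) ≤ (t : ℝ) / p := Nat.cast_div_le
    have h2 : (q : ℝ) = ((t / p : ℕ) : ℝ) + 1 := by rw [hq]; push_cast; ring
    have h3 : (t : ℝ) / p * a * l ≤ t * a := by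
      rw [div_mul_eq_mul_div, div_mul_eq_mul_div, div_le_iff₀ hp0]
      exact mul_le_mul_of_nonneg_left hpl (by positivity)
    have h4 : ((t / p : ℕ) : ℝ) * a * l ≤ (t : ℝ) / p * a * l := by gcongr
    rw [h2, add_mul, add_mul, one_mul]
    linarith
  calc (Mmin k n : ℝ) ^ a ≤ (Real.exp (q * (4 * l) + t * (7 + l / 2))) ^ a :=
        Real.rpow_le_rpow (Nat.cast_nonneg _) hM ha0
    _ = Real.exp ((q * (4 * l) + t * (7 + l / 2)) * a) := by rw [← Real.exp_mul]
    _ ≤ Real.exp (40 + l * (1 / 4)) := by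
        apply Real.exp_le_exp.2
        have h1 : (t : ℝ) * a * (7 + l / 2) ≤ (1 / 2 + a) * (7 + l / 2) :=
          mul_le_mul_of_nonneg_right hta (by linarith)
        nlinarith
    _ = Real.exp 40 * (k : ℝ) ^ ((1 : ℝ) / 4) := by
        rw [Real.exp_add, Real.rpow_def_of_pos hk0]
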